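/- arXiv:1812.08844 — 2 statements merged into one kernel-verified Lean document; each statement's English description precedes it below -/
import Mathlib

section
/- Let U be an open bounded subset of E₁ with f⁻¹(0) ⊆ U ⊆ cl U ⊆ D_f, and let W be an open subset with f⁻¹(0) ⊆ W ⊆ U. Then there exists N ∈ ℕ such that for all n ≥ N, all t ∈ [0,1], and all x in the boundary, taken inside the finite-dimensional space V_{n+1}, of the set W ∩ V_{n+1}, one has Ax − (1−t)P_{n+1}F(x) − t PₙF(Pₙx) ≠ 0. (The map at t = 0 is the approximation f_{n+1}(x) = Ax − P_{n+1}F(x), and at t = 1 it is the product map fₙ × A_{n+1}, where fₙ(u) = Au − PₙF(u) on Vₙ and A_{n+1} is the restriction of A to the span of {e_k : n < |λ_k| ≤ n+1}.) -/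
open Filter Topology Bornology
open scoped RealInnerProductSpace

/-- The orthogonal projection `Pₙ : E → Vₙ` onto `Vₙ = span {e k : |λ k| ≤ n}`,
given by `Pₙ x = ∑_{|λ k| ≤ n} ⟪x, e k⟫ e k`. -/
noncomputable def projP {E : Type*} [NormedAddCommGroup E] [InnerProductSpace ℝ E]
    (e : HilbertBasis ℕ ℝ E) (lam : ℕ → ℝ) (n : ℕ) (x : E) : E :=
  ∑' k : {k : ℕ // |lam k| ≤ (n : ℝ)}, e.repr x (k : ℕ) • e (k : ℕ)

/-- The finite-dimensional subspace `Vₙ = span {e k : |λ k| ≤ n}` of `E`. -/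
def spanV {E : Type*} [NormedAddCommGroup E] [InnerProductSpace ℝ E]
    (e : HilbertBasis ℕ ℝ E) (lam : ℕ → ℝ) (n : ℕ) : Submodule ℝ E :=
  Submodule.span ℝ ((fun k => e k) '' {k : ℕ | |lam k| ≤ (n : ℝ)})

/-- The operator `A` at the level of `E` (defined on `D`, junk value elsewhere):
`A y = ∑' k, λ k ⟪y, e k⟫ • e k`. -/
noncomputable def Aop {E : Type*} [NormedAddCommGroup E] [InnerProductSpace ℝ E]
    (e : HilbertBasis ℕ ℝ E) (lam : ℕ → ℝ) (y : E) : E :=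
  ∑' (k : ℕ), (lam k * e.repr y k) • e k

namespace HilbertBasis

variable {E : Type*} [NormedAddCommGroup E] [InnerProductSpace ℝ E]

theorem norm_le_of_abs_repr_le (e : HilbertBasis ℕ ℝ E) {z w : E}
    (h : ∀ k, |e.repr z k| ≤ |e.repr w k|) : ‖z‖ ≤ ‖w‖ := by
  rw [← e.repr.norm_map z, ← e.repr.norm_map w]
  have hs : ∀ u : lp (fun _ : ℕ => ℝ) 2, HasSum (fun k => |u k| ^ 2) (‖u‖ ^ 2) := fun u => by
    simpa using lp.hasSum_norm (p := 2) (by norm_num) u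
  refine (sq_le_sq₀ (norm_nonneg _) (norm_nonneg _)).1 (hasSum_le (fun k => ?_) (hs _) (hs _))
  exact pow_le_pow_left₀ (abs_nonneg _) (h k) 2

theorem repr_tsum_smul (e : HilbertBasis ℕ ℝ E) {a : ℕ → ℝ}
    (ha : Summable fun k => a k ^ 2) (k : ℕ) : e.repr (∑' n, a n • e n) k = a k := by
  have hmem : Memℓp a 2 := memℓp_gen (by simpa using ha)
  have h := (e.hasSum_repr_symm ⟨a, hmem⟩).tsum_eq
  have h' : ∑' n, a n • e n = e.repr.symm ⟨a, hmem⟩ := h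
  rw [h']
  simp

theorem repr_apply_basis (e : HilbertBasis ℕ ℝ E) (i k : ℕ) :
    e.repr (e i) k = if k = i then 1 else 0 := by
  classical
  rw [e.repr_apply_apply, orthonormal_iff_ite.1 e.orthonormal]

end HilbertBasis

section Projection

variable {E : Type*} [NormedAddCommGroup E] [InnerProductSpace ℝ E]
  {lam : ℕ → ℝ}

theorem finite_setOf_abs_le (hlam : Tendsto (fun n => |lam n|) atTop atTop) (r : ℝ) :
    {k : ℕ | |lam k| ≤ r}.Finite := by
  have h := hlam.eventually_gt_atTop r
  rw [← Nat.cofinite_eq_atTop, eventually_cofinite] at h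
  simpa using h

theorem projP_eq_sum (e : HilbertBasis ℕ ℝ E)
    (hlam : Tendsto (fun n => |lam n|) atTop atTop) (n : ℕ) (x : E) :
    projP e lam n x =
      ∑ k ∈ (finite_setOf_abs_le hlam n).toFinset, e.repr x k • e k := by
  rw [← Finset.tsum_subtype, projP]
  exact (Equiv.subtypeEquivRight (by simp)).tsum_eq
    (fun k : {k // k ∈ (finite_setOf_abs_le hlam n).toFinset} => e.repr x k • e k)

theorem repr_projP (e : HilbertBasis ℕ ℝ E)
    (hlam : Tendsto (fun n => |lam n|) atTop atTop) (n : ℕ) (x : E) (k : ℕ) :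
    e.repr (projP e lam n x) k = if |lam k| ≤ n then e.repr x k else 0 := by
  rw [projP_eq_sum e hlam, e.repr_apply_apply, inner_sum]
  simp [inner_smul_right, orthonormal_iff_ite.1 e.orthonormal]

theorem projP_sub (e : HilbertBasis ℕ ℝ E)
    (hlam : Tendsto (fun n => |lam n|) atTop atTop) (n : ℕ) (x y : E) :
    projP e lam n (x - y) = projP e lam n x - projP e lam n y := by
  simp only [projP_eq_sum e hlam, ← Finset.sum_sub_distrib, map_sub, lp.coeFn_sub, Pi.sub_apply,
    sub_smul]

theorem norm_projP_le (e : HilbertBasis ℕ ℝ E)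
    (hlam : Tendsto (fun n => |lam n|) atTop atTop) (n : ℕ) (x : E) :
    ‖projP e lam n x‖ ≤ ‖x‖ := by
  refine e.norm_le_of_abs_repr_le fun k => ?_
  rw [repr_projP e hlam]
  split_ifs <;> simp

theorem tendsto_projP (e : HilbertBasis ℕ ℝ E)
    (hlam : Tendsto (fun n => |lam n|) atTop atTop) (x : E) :
    Tendsto (fun n => projP e lam n x) atTop (𝓝 x) := by
  simp only [projP_eq_sum e hlam]
  refine (e.hasSum_repr x).comp (tendsto_atTop_finset_of_monotone (fun m n hmn k hk => ?_)
    fun k => ?_)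
  · simp only [Set.Finite.mem_toFinset, Set.mem_ofPred_eq] at hk ⊢
    exact hk.trans (by exact_mod_cast hmn)
  · obtain ⟨n, hn⟩ := exists_nat_ge |lam k|
    exact ⟨n, by simpa using hn⟩

theorem tendsto_projP_of_tendsto (e : HilbertBasis ℕ ℝ E)
    (hlam : Tendsto (fun n => |lam n|) atTop atTop) {α : Type*} {l : Filter α} {m : α → ℕ}
    (hm : Tendsto m l atTop) {u : α → E} {y : E} (hu : Tendsto u l (𝓝 y)) :
    Tendsto (fun i => projP e lam (m i) (u i)) l (𝓝 y) := by
  have hdiff : Tendsto (fun i => projP e lam (m i) (u i - y)) l (𝓝 0) :=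
    squeeze_zero_norm (fun i => norm_projP_le e hlam _ _)
      (by simpa using (hu.sub_const y).norm)
  simpa [projP_sub e hlam] using hdiff.add ((tendsto_projP e hlam y).comp hm)

theorem finiteDimensional_spanV (e : HilbertBasis ℕ ℝ E)
    (hlam : Tendsto (fun n => |lam n|) atTop atTop) (n : ℕ) :
    FiniteDimensional ℝ (spanV e lam n) :=
  FiniteDimensional.span_of_finite ℝ ((finite_setOf_abs_le hlam n).image _)

/-- The projection `projP` as a continuous linear map. -/
noncomputable def projPL (e : HilbertBasis ℕ ℝ E)
    (hlam : Tendsto (fun n => |lam n|) atTop atTop) (n : ℕ) : E →L[ℝ] E :=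
  ∑ k ∈ (finite_setOf_abs_le hlam n).toFinset, (innerSL ℝ (e k)).smulRight (e k)

theorem projPL_apply (e : HilbertBasis ℕ ℝ E)
    (hlam : Tendsto (fun n => |lam n|) atTop atTop) (n : ℕ) (x : E) :
    projPL e hlam n x = projP e lam n x := by
  simp [projPL, projP_eq_sum e hlam, e.repr_apply_apply]

theorem isCompactOperator_projPL (e : HilbertBasis ℕ ℝ E)
    (hlam : Tendsto (fun n => |lam n|) atTop atTop) (n : ℕ) :
    IsCompactOperator (projPL e hlam n) := by
  have := finiteDimensional_spanV e hlam n
  have hmem : ∀ x, projPL e hlam n x ∈ spanV e lam n := fun x => by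
    rw [projPL_apply, projP_eq_sum e hlam]
    exact Submodule.sum_mem _ fun k hk => Submodule.smul_mem _ _
      (Submodule.subset_span ⟨k, by simpa using hk, rfl⟩)
  have hc : IsCompactOperator ((projPL e hlam n).codRestrict _ hmem) := by
    refine (isCompactOperator_iff_isCompact_closure_image_closedBall
      ((projPL e hlam n).codRestrict _ hmem).toLinearMap one_pos).2 ?_
    have := FiniteDimensional.proper ℝ (spanV e lam n)
    exact (((projPL e hlam n).codRestrict _ hmem).lipschitz.isBounded_image
      Metric.isBounded_closedBall).isCompact_closure
  exact hc.clm_comp (spanV e lam n).subtypeL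

end Projection

section GraphSpace

variable {E : Type*} [NormedAddCommGroup E] [InnerProductSpace ℝ E]
  {lam : ℕ → ℝ}
  {E₁ : Type*} [NormedAddCommGroup E₁] [InnerProductSpace ℝ E₁]
  {ι : E₁ →ₗ[ℝ] E} {A : E₁ → E}

theorem norm_sq_eq_of_graph (hgraph : ∀ x y : E₁, ⟪x, y⟫ = ⟪ι x, ι y⟫ + ⟪A x, A y⟫) (x : E₁) :
    ‖x‖ ^ 2 = ‖ι x‖ ^ 2 + ‖A x‖ ^ 2 := by
  simpa using hgraph x x

theorem repr_graph_apply (e : HilbertBasis ℕ ℝ E)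
    (hrange : Set.range ι = {x : E | Summable fun n => lam n ^ 2 * e.repr x n ^ 2})
    (hA : ∀ x : E₁, A x = ∑' (n : ℕ), (lam n * e.repr (ι x) n) • e n) (x : E₁) (k : ℕ) :
    e.repr (A x) k = lam k * e.repr (ι x) k := by
  rw [hA, e.repr_tsum_smul]
  have h : ι x ∈ {x : E | Summable fun n => lam n ^ 2 * e.repr x n ^ 2} :=
    hrange ▸ Set.mem_range_self x
  simpa [mul_pow] using h

theorem graph_map_sub (e : HilbertBasis ℕ ℝ E)
    (hrange : Set.range ι = {x : E | Summable fun n => lam n ^ 2 * e.repr x n ^ 2})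
    (hA : ∀ x : E₁, A x = ∑' (n : ℕ), (lam n * e.repr (ι x) n) • e n) (x y : E₁) :
    A (x - y) = A x - A y := by
  apply e.repr.injective
  ext k
  simp [repr_graph_apply e hrange hA, mul_sub]

theorem isCompactOperator_graph_inclusion [CompleteSpace E] (e : HilbertBasis ℕ ℝ E)
    (hlam : Tendsto (fun n => |lam n|) atTop atTop)
    (hrange : Set.range ι = {x : E | Summable fun n => lam n ^ 2 * e.repr x n ^ 2})
    (hA : ∀ x : E₁, A x = ∑' (n : ℕ), (lam n * e.repr (ι x) n) • e n)
    (hgraph : ∀ x y : E₁, ⟪x, y⟫ = ⟪ι x, ι y⟫ + ⟪A x, A y⟫) :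
    IsCompactOperator ι := by
  have hι1 : ∀ x, ‖ι x‖ ≤ 1 * ‖x‖ := fun x => by
    rw [one_mul, ← sq_le_sq₀ (norm_nonneg _) (norm_nonneg _), norm_sq_eq_of_graph hgraph x]
    exact le_add_of_nonneg_right (sq_nonneg _)
  have hA1 : ∀ x, ‖A x‖ ≤ ‖x‖ := fun x => by
    rw [← sq_le_sq₀ (norm_nonneg _) (norm_nonneg _), norm_sq_eq_of_graph hgraph x]
    exact le_add_of_nonneg_left (sq_nonneg _)
  let j : E₁ →L[ℝ] E := ι.mkContinuous 1 hι1
  have hbound : ∀ (n : ℕ) (x : E₁), (n + 1 : ℝ) * ‖projP e lam (n + 1) (ι x) - ι x‖ ≤ ‖x‖ := by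
    intro n x
    have hn : (0 : ℝ) ≤ n + 1 := by positivity
    refine le_trans ?_ (hA1 x)
    rw [← norm_smul_of_nonneg hn]
    refine e.norm_le_of_abs_repr_le fun k => ?_
    simp only [map_smul, map_sub, lp.coeFn_smul, lp.coeFn_sub, Pi.smul_apply, Pi.sub_apply,
      smul_eq_mul, repr_projP e hlam, repr_graph_apply e hrange hA, abs_mul]
    split_ifs with h
    · simpa using mul_nonneg (abs_nonneg _) (abs_nonneg _)
    · push_cast at h
      rw [zero_sub, abs_neg, abs_of_nonneg hn]
      exact mul_le_mul_of_nonneg_right (not_le.1 h).le (abs_nonneg _)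
  have hlim : Tendsto (fun n : ℕ => (projPL e hlam (n + 1)).comp j) atTop (𝓝 j) := by
    rw [tendsto_iff_norm_sub_tendsto_zero]
    refine squeeze_zero (fun _ => norm_nonneg _) (fun n => ?_)
      (tendsto_one_div_add_atTop_nhds_zero_nat (𝕜 := ℝ))
    refine ContinuousLinearMap.opNorm_le_bound _ (by positivity) fun x => ?_
    have hn : (0 : ℝ) < n + 1 := by positivity
    rw [one_div, inv_mul_eq_div, le_div_iff₀ hn, mul_comm]
    simpa [j, projPL_apply] using hbound n x
  exact isCompactOperator_of_tendsto hlim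
    (Eventually.of_forall fun n => (isCompactOperator_projPL e hlam (n + 1)).comp_clm j)

theorem spanV_le_range (e : HilbertBasis ℕ ℝ E)
    (hrange : Set.range ι = {x : E | Summable fun n => lam n ^ 2 * e.repr x n ^ 2}) (n : ℕ) :
    spanV e lam n ≤ LinearMap.range ι := by
  refine Submodule.span_le.2 ?_
  rintro _ ⟨i, -, rfl⟩
  rw [LinearMap.coe_range, hrange]
  refine summable_of_ne_finset_zero (s := {i}) fun k hk => ?_
  have hki : k ≠ i := by simpa using hk
  simp [e.repr_apply_basis, hki]

theorem exists_mem_frontier_of_mem_frontier_spanV (e : HilbertBasis ℕ ℝ E)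
    (hlam : Tendsto (fun n => |lam n|) atTop atTop) (hι : Function.Injective ι)
    (hrange : Set.range ι = {x : E | Summable fun n => lam n ^ 2 * e.repr x n ^ 2})
    (W : Set E₁) (n : ℕ) {v : spanV e lam n}
    (hv : v ∈ frontier {w : spanV e lam n | (w : E) ∈ ι '' W}) :
    ∃ x ∈ frontier W, ι x = v := by
  have := finiteDimensional_spanV e hlam n
  let j : spanV e lam n →ₗ[ℝ] E₁ :=
    (LinearEquiv.ofInjective ι hι).symm.toLinearMap ∘ₗ
      Submodule.inclusion (spanV_le_range e hrange n)
  have hj : ∀ w, ι (j w) = w := fun w =>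
    congrArg Subtype.val ((LinearEquiv.ofInjective ι hι).apply_symm_apply
      (Submodule.inclusion (spanV_le_range e hrange n) w))
  have hset : {w : spanV e lam n | (w : E) ∈ ι '' W} = j ⁻¹' W := by
    ext w
    rw [Set.mem_ofPred_eq, ← hj w, hι.mem_set_image, Set.mem_preimage]
  rw [hset] at hv
  exact ⟨j v, j.continuous_of_finiteDimensional.frontier_preimage_subset W hv, hj v⟩

theorem exists_tendsto_of_graph [CompleteSpace E₁] (e : HilbertBasis ℕ ℝ E)
    (hrange : Set.range ι = {x : E | Summable fun n => lam n ^ 2 * e.repr x n ^ 2})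
    (hA : ∀ x : E₁, A x = ∑' (n : ℕ), (lam n * e.repr (ι x) n) • e n)
    (hgraph : ∀ x y : E₁, ⟪x, y⟫ = ⟪ι x, ι y⟫ + ⟪A x, A y⟫)
    {x : ℕ → E₁} {y z : E} (hy : Tendsto (fun i => ι (x i)) atTop (𝓝 y))
    (hz : Tendsto (fun i => A (x i)) atTop (𝓝 z)) :
    ∃ a, Tendsto x atTop (𝓝 a) ∧ ι a = y ∧ A a = z := by
  have hdist : ∀ a b : E₁, dist a b ^ 2 = dist (ι a) (ι b) ^ 2 + dist (A a) (A b) ^ 2 :=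
    fun a b => by
      simp only [dist_eq_norm, ← map_sub, ← graph_map_sub e hrange hA]
      exact norm_sq_eq_of_graph hgraph _
  have hdist_ι : ∀ a b : E₁, dist (ι a) (ι b) ≤ dist a b := fun a b =>
    (sq_le_sq₀ dist_nonneg dist_nonneg).1
      ((hdist a b).symm ▸ le_add_of_nonneg_right (sq_nonneg _))
  have hdist_A : ∀ a b : E₁, dist (A a) (A b) ≤ dist a b := fun a b =>
    (sq_le_sq₀ dist_nonneg dist_nonneg).1
      ((hdist a b).symm ▸ le_add_of_nonneg_left (sq_nonneg _))
  have hx : CauchySeq x := by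
    rw [cauchySeq_iff_tendsto_dist_atTop_0]
    have h := (cauchySeq_iff_tendsto_dist_atTop_0.1 hy.cauchySeq).add
      (cauchySeq_iff_tendsto_dist_atTop_0.1 hz.cauchySeq)
    rw [add_zero] at h
    refine squeeze_zero (fun _ => dist_nonneg) (fun p => ?_) h
    refine abs_le_of_sq_le_sq' ?_ (by positivity) |>.2
    rw [hdist]
    nlinarith [mul_nonneg (dist_nonneg (x := ι (x p.1)) (y := ι (x p.2)))
      (dist_nonneg (x := A (x p.1)) (y := A (x p.2)))]
  obtain ⟨a, ha⟩ := cauchySeq_tendsto_of_complete hx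
  have hcont_ι : Continuous ι :=
    (LipschitzWith.of_dist_le_mul (K := 1) (by simpa using hdist_ι)).continuous
  have hcont_A : Continuous A :=
    (LipschitzWith.of_dist_le_mul (K := 1) (by simpa using hdist_A)).continuous
  exact ⟨a, ha, tendsto_nhds_unique ((hcont_ι.tendsto a).comp ha) hy,
    tendsto_nhds_unique ((hcont_A.tendsto a).comp ha) hz⟩

end GraphSpace

/-- Let `U` be open bounded in `E₁` with `f⁻¹(0) ⊆ U ⊆ cl U ⊆ D_f`,
and `W` open with `f⁻¹(0) ⊆ W ⊆ U`. Then there is `N` such that for all `n ≥ N`,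
`t ∈ [0,1]` and all `x` in the boundary, taken inside the finite-dimensional space
`V_{n+1}`, of `W ∩ V_{n+1}`, one has `A x − (1−t) P_{n+1} F x − t Pₙ F (Pₙ x) ≠ 0`.
(At `t = 0` this is the approximation `f_{n+1}`, at `t = 1` the product map
`fₙ × A_{n+1}`.) -/
theorem stmt_11
    {E : Type*} [NormedAddCommGroup E] [InnerProductSpace ℝ E] [CompleteSpace E]
    (e : HilbertBasis ℕ ℝ E) (lam : ℕ → ℝ)
    (hlam : Tendsto (fun n => |lam n|) atTop atTop)
    {E₁ : Type*} [NormedAddCommGroup E₁] [InnerProductSpace ℝ E₁] [CompleteSpace E₁]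
    (ι : E₁ →ₗ[ℝ] E) (hι : Function.Injective ι)
    (hrange : Set.range ι = {x : E | Summable fun n => lam n ^ 2 * e.repr x n ^ 2})
    (A : E₁ → E)
    (hA : ∀ x : E₁, A x = ∑' (n : ℕ), (lam n * e.repr (ι x) n) • e n)
    (hgraph : ∀ x y : E₁, ⟪x, y⟫ = ⟪ι x, ι y⟫ + ⟪A x, A y⟫)
    (F : E → E) (hF : Continuous F)
    (Df : Set E₁) (hDf : IsOpen Df)
    (hzc : IsCompact {x : E₁ | x ∈ Df ∧ A x - F (ι x) = 0})
    (U : Set E₁) (hUopen : IsOpen U) (hUbdd : IsBounded U)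
    (hzU : {x : E₁ | x ∈ Df ∧ A x - F (ι x) = 0} ⊆ U)
    (hclU : closure U ⊆ Df)
    (W : Set E₁) (hWopen : IsOpen W)
    (hzW : {x : E₁ | x ∈ Df ∧ A x - F (ι x) = 0} ⊆ W) (hWU : W ⊆ U) :
    ∃ N : ℕ, ∀ n ≥ N, ∀ t ∈ Set.Icc (0 : ℝ) 1,
      ∀ v : spanV e lam (n + 1),
        v ∈ frontier {w : spanV e lam (n + 1) | (w : E) ∈ ι '' W} →
        Aop e lam (v : E) - (1 - t) • projP e lam (n + 1) (F (v : E)) -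
          t • projP e lam n (F (projP e lam n (v : E))) ≠ 0 := by
  by_contra! hcon
  choose n hn t ht v hv hzero using hcon
  choose x hxW hxv using fun N =>
    exists_mem_frontier_of_mem_frontier_spanV e hlam hι hrange W (n N + 1) (hv N)
  have hxU : ∀ N, x N ∈ closure U := fun N => closure_mono hWU (frontier_subset_closure (hxW N))
  obtain ⟨y, -, φ, hφ, hy⟩ :=
    ((isCompactOperator_graph_inclusion e hlam hrange hA hgraph).isCompact_closure_image_of_isVonNBounded
      (NormedSpace.isVonNBounded_iff ℝ |>.2 hUbdd.closure)).tendsto_subseq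
      fun N => subset_closure (Set.mem_image_of_mem ι (hxU N))
  have hnφ : Tendsto (fun i => n (φ i)) atTop atTop :=
    (tendsto_atTop_mono hn tendsto_id).comp hφ.tendsto_atTop
  have hu : Tendsto (fun i => projP e lam (n (φ i) + 1) (F (ι (x (φ i))))) atTop (𝓝 (F y)) :=
    tendsto_projP_of_tendsto e hlam ((tendsto_add_atTop_nat 1).comp hnφ)
      ((hF.tendsto y).comp hy)
  have hw : Tendsto (fun i => projP e lam (n (φ i)) (F (projP e lam (n (φ i)) (ι (x (φ i))))))
      atTop (𝓝 (F y)) :=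
    tendsto_projP_of_tendsto e hlam hnφ
      ((hF.tendsto y).comp (tendsto_projP_of_tendsto e hlam hnφ hy))
  have hAx : Tendsto (fun i => A (x (φ i))) atTop (𝓝 (F y)) := by
    have heq : ∀ i, A (x (φ i)) = projP e lam (n (φ i) + 1) (F (ι (x (φ i)))) +
        t (φ i) • (projP e lam (n (φ i)) (F (projP e lam (n (φ i)) (ι (x (φ i))))) -
          projP e lam (n (φ i) + 1) (F (ι (x (φ i))))) := fun i => by
      have h := hzero (φ i)
      rw [← hxv, Aop, ← hA, sub_sub, sub_eq_zero] at h
      rw [h]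
      module
    have hdiff := hw.sub hu
    rw [sub_self] at hdiff
    have hsmul : Tendsto (fun i => t (φ i) •
        (projP e lam (n (φ i)) (F (projP e lam (n (φ i)) (ι (x (φ i))))) -
          projP e lam (n (φ i) + 1) (F (ι (x (φ i)))))) atTop (𝓝 0) := by
      refine squeeze_zero_norm (fun i => ?_) (by simpa using hdiff.norm)
      rw [norm_smul, Real.norm_of_nonneg (ht (φ i)).1]
      exact mul_le_of_le_one_left (norm_nonneg _) (ht (φ i)).2
    simpa only [heq, add_zero] using hu.add hsmul
  obtain ⟨a, ha, haι, haA⟩ := exists_tendsto_of_graph e hrange hA hgraph hy hAx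
  have hafr : a ∈ frontier W :=
    isClosed_frontier.mem_of_tendsto ha (Eventually.of_forall fun i => hxW (φ i))
  have haW : a ∈ W :=
    hzW ⟨hclU (closure_mono hWU (frontier_subset_closure hafr)), by rw [haA, haι, sub_self]⟩
  exact hafr.2 (hWopen.interior_eq.symm ▸ haW)
end

section
/- Let W be an open bounded subset of [0,1] × E₁ with h⁻¹(0) ⊆ W ⊆ cl W ⊆ Λ. Then there exists ε > 0 such that ‖h(t,x)‖ ≥ 2ε for every (t,x) in the boundary ∂W of W in [0,1] × E₁. -/
open Filter Topology Bornology
open scoped RealInnerProductSpace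

theorem HilbertBasis.hasSum_sq_repr {I E : Type*} [NormedAddCommGroup E] [InnerProductSpace ℝ E]
    (e : HilbertBasis I ℝ E) (x : E) : HasSum (fun i => e.repr x i ^ 2) (‖x‖ ^ 2) := by
  have h := e.hasSum_inner_mul_inner x x
  rw [real_inner_self_eq_norm_sq] at h
  simpa only [e.repr_apply_apply, real_inner_comm (e _) x, sq] using h

theorem HilbertBasis.repr_tsum_smul_s12 {I E : Type*} [NormedAddCommGroup E] [InnerProductSpace ℝ E]
    (e : HilbertBasis I ℝ E) {c : I → ℝ} (hc : Summable fun i => c i ^ 2) (i : I) :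
    e.repr (∑' j, c j • e j) i = c i := by
  have hmem : Memℓp c 2 := by
    apply memℓp_gen
    simpa using hc
  have h := (e.hasSum_repr_symm ⟨c, hmem⟩).tsum_eq
  change ∑' j, c j • e j = _ at h
  rw [h, LinearIsometryEquiv.apply_symm_apply]

/-- A continuous linear map into a Hilbert space whose coordinates, weighted by a sequence tending
to infinity in absolute value, remain square summable with a uniform bound, is compact. -/
theorem HilbertBasis.isCompactOperator_of_tsum_weighted_le {V E : Type*}
    [NormedAddCommGroup V] [NormedSpace ℝ V]
    [NormedAddCommGroup E] [InnerProductSpace ℝ E] [CompleteSpace E]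
    (e : HilbertBasis ℕ ℝ E) {lam : ℕ → ℝ} (hlam : Tendsto (fun n => |lam n|) atTop atTop)
    (T : V →L[ℝ] E) (hsum : ∀ x, Summable fun n => lam n ^ 2 * e.repr (T x) n ^ 2)
    (hle : ∀ x, ∑' n, lam n ^ 2 * e.repr (T x) n ^ 2 ≤ ‖x‖ ^ 2) :
    IsCompactOperator T := by
  let P : ℕ → V →L[ℝ] E := fun N =>
    ∑ i ∈ Finset.range N, ((innerSL ℝ (e i)).comp T).smulRight (e i)
  have hPapply (N : ℕ) (x : V) : P N x = ∑ i ∈ Finset.range N, e.repr (T x) i • e i := by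
    simp [P, e.repr_apply_apply]
  have hP : ∀ N, IsCompactOperator (P N) := fun N =>
    Submodule.sum_mem (compactOperator (RingHom.id ℝ) V E) (t := Finset.range N)
      (f := fun i => ((innerSL ℝ (e i)).comp T).smulRight (e i)) (fun i _ =>
        (isCompactOperator_of_locallyCompactSpace_dom ((innerSL ℝ (e i)).comp T)).clm_comp
          ((ContinuousLinearMap.id ℝ ℝ).smulRight (e i)))
  refine isCompactOperator_of_tendsto (F := P) (l := atTop) ?_ (Eventually.of_forall hP)
  rw [Metric.tendsto_atTop]
  intro δ hδ
  obtain ⟨N₀, hN₀⟩ := eventually_atTop.1 (hlam.eventually_ge_atTop (2 / δ))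
  refine ⟨N₀, fun N hN => ?_⟩
  rw [dist_comm, dist_eq_norm]
  refine (ContinuousLinearMap.opNorm_le_bound _ (half_pos hδ).le fun x => ?_).trans_lt
    (half_lt_self hδ)
  have hcoord (n : ℕ) : e.repr ((T - P N) x) n = if n < N then 0 else e.repr (T x) n := by
    rw [sub_apply, hPapply, e.repr_apply_apply, inner_sub_right, inner_sum,
      e.repr_apply_apply]
    simp only [inner_smul_right, orthonormal_iff_ite.1 e.orthonormal]
    simp [e.repr_apply_apply]
    split_ifs <;> simp
  have hbound (n : ℕ) : e.repr ((T - P N) x) n ^ 2 ≤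
      (δ / 2) ^ 2 * (lam n ^ 2 * e.repr (T x) n ^ 2) := by
    rw [hcoord]
    split_ifs with hn
    · rw [zero_pow two_ne_zero]
      positivity
    · have h1 : 2 / δ ≤ |lam n| := hN₀ n (hN.trans (not_lt.1 hn))
      have h2 : 1 ≤ δ / 2 * |lam n| := by
        rw [div_le_iff₀ hδ] at h1
        linarith
      have h3 : 1 ≤ (δ / 2) ^ 2 * lam n ^ 2 := by
        rw [← sq_abs (lam n), ← mul_pow]
        exact one_le_pow₀ h2
      nlinarith [sq_nonneg (e.repr (T x) n)]
  have hnorm : ‖(T - P N) x‖ ^ 2 ≤ (δ / 2 * ‖x‖) ^ 2 := by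
    have h := hasSum_le hbound (e.hasSum_sq_repr _) ((hsum x).hasSum.mul_left _)
    rw [mul_pow]
    exact h.trans (mul_le_mul_of_nonneg_left (hle x) (sq_nonneg _))
  exact le_of_sq_le_sq hnorm (by positivity)

/-- Let `h : Λ ⊆ [0,1] × E₁ → E`, `h (t,x) = A x − F (t, ι x)`, be an
otopy (with `F` continuous and `h⁻¹(0)` compact). Let `W` be an open bounded subset of
`[0,1] × E₁` with `h⁻¹(0) ⊆ W ⊆ cl W ⊆ Λ`. Then there exists `ε > 0` such that
`‖h (t,x)‖ ≥ 2ε` for every `(t,x)` in the boundary `∂W` of `W` in `[0,1] × E₁`. -/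
theorem stmt_12
    {E : Type*} [NormedAddCommGroup E] [InnerProductSpace ℝ E] [CompleteSpace E]
    (e : HilbertBasis ℕ ℝ E) (lam : ℕ → ℝ)
    (hlam : Tendsto (fun n => |lam n|) atTop atTop)
    {E₁ : Type*} [NormedAddCommGroup E₁] [InnerProductSpace ℝ E₁] [CompleteSpace E₁]
    (ι : E₁ →ₗ[ℝ] E) (hι : Function.Injective ι)
    (hrange : Set.range ι = {x : E | Summable fun n => lam n ^ 2 * e.repr x n ^ 2})
    (A : E₁ → E)
    (hA : ∀ x : E₁, A x = ∑' (n : ℕ), (lam n * e.repr (ι x) n) • e n)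
    (hgraph : ∀ x y : E₁, ⟪x, y⟫ = ⟪ι x, ι y⟫ + ⟪A x, A y⟫)
    (F : unitInterval × E → E) (hF : Continuous F)
    (Λ : Set (unitInterval × E₁)) (hΛ : IsOpen Λ)
    (hzc : IsCompact {p : unitInterval × E₁ | p ∈ Λ ∧ A p.2 - F (p.1, ι p.2) = 0})
    (W : Set (unitInterval × E₁)) (hWopen : IsOpen W) (hWbdd : IsBounded W)
    (hzW : {p : unitInterval × E₁ | p ∈ Λ ∧ A p.2 - F (p.1, ι p.2) = 0} ⊆ W)
    (hclW : closure W ⊆ Λ) :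
    ∃ ε > 0, ∀ p ∈ frontier W, 2 * ε ≤ ‖A p.2 - F (p.1, ι p.2)‖ := by
  have hnorm (x : E₁) : ‖x‖ ^ 2 = ‖ι x‖ ^ 2 + ‖A x‖ ^ 2 := by
    simpa only [real_inner_self_eq_norm_sq] using hgraph x x
  have hdist (x y : E₁) : ‖A x - A y‖ ^ 2 + ‖ι x - ι y‖ ^ 2 = ‖x - y‖ ^ 2 := by
    rw [norm_sub_sq_real, norm_sub_sq_real, norm_sub_sq_real, hgraph x y, hnorm x, hnorm y]
    ring
  have hAlip : LipschitzWith 1 A := LipschitzWith.of_dist_le_mul fun x y => by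
    rw [dist_eq_norm, dist_eq_norm, NNReal.coe_one, one_mul]
    exact le_of_sq_le_sq (by nlinarith [hdist x y, sq_nonneg ‖ι x - ι y‖]) (norm_nonneg _)
  let T : E₁ →L[ℝ] E := ι.mkContinuous 1 fun x => by
    rw [one_mul]
    exact le_of_sq_le_sq (by nlinarith [hnorm x, sq_nonneg ‖A x‖]) (norm_nonneg _)
  have hsum (x : E₁) : Summable fun n => lam n ^ 2 * e.repr (ι x) n ^ 2 :=
    hrange.subset (Set.mem_range_self x)
  have hAsum (x : E₁) : HasSum (fun n => lam n ^ 2 * e.repr (ι x) n ^ 2) (‖A x‖ ^ 2) := by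
    have hcoord (n : ℕ) : e.repr (A x) n = lam n * e.repr (ι x) n := by
      rw [hA]
      exact e.repr_tsum_smul_s12 (by simpa only [mul_pow] using hsum x) n
    simpa only [hcoord, mul_pow] using e.hasSum_sq_repr (A x)
  have hTcompact : IsCompactOperator T :=
    e.isCompactOperator_of_tsum_weighted_le hlam T hsum fun x =>
      (hAsum x).tsum_eq.trans_le (by nlinarith [hnorm x, sq_nonneg ‖ι x‖])
  have hWcbdd : IsBounded (Prod.snd '' closure W) :=
    LipschitzWith.prod_snd.isBounded_image hWbdd.closure
  obtain ⟨K, hK, hKsub⟩ :=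
    IsCompactOperator.image_subset_compact_of_bounded (f := T.toLinearMap) hTcompact hWcbdd
  by_contra! hcon
  choose p hpW hp using fun n : ℕ => hcon (1 / ((n : ℝ) + 1)) (by positivity)
  have hhp : Tendsto (fun n => A (p n).2 - F ((p n).1, ι (p n).2)) atTop (𝓝 0) := by
    refine squeeze_zero_norm (fun n => (hp n).le) ?_
    simpa using tendsto_one_div_add_atTop_nhds_zero_nat.const_mul (2 : ℝ)
  have hq (n : ℕ) : ((p n).1, ι (p n).2) ∈ (Set.univ : Set unitInterval) ×ˢ K :=
    ⟨Set.mem_univ _, hKsub ⟨_, ⟨_, frontier_subset_closure (hpW n), rfl⟩, rfl⟩⟩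
  obtain ⟨⟨t, y⟩, -, φ, hφ, hlim⟩ := (isCompact_univ.prod hK).tendsto_subseq hq
  have hιlim : Tendsto (fun n => ι (p (φ n)).2) atTop (𝓝 y) :=
    (continuous_snd.tendsto (t, y)).comp hlim
  have hAlim : Tendsto (fun n => A (p (φ n)).2) atTop (𝓝 (F (t, y))) := by
    simpa using (hhp.comp hφ.tendsto_atTop).add ((hF.tendsto (t, y)).comp hlim)
  have hcauchy : CauchySeq fun n => (p (φ n)).2 := by
    rw [Metric.cauchySeq_iff]
    intro δ hδ
    obtain ⟨N₁, hN₁⟩ := Metric.cauchySeq_iff.1 hιlim.cauchySeq (δ / 2) (half_pos hδ)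
    obtain ⟨N₂, hN₂⟩ := Metric.cauchySeq_iff.1 hAlim.cauchySeq (δ / 2) (half_pos hδ)
    refine ⟨max N₁ N₂, fun m hm n hn => ?_⟩
    have h₁ := hN₁ m (le_of_max_le_left hm) n (le_of_max_le_left hn)
    have h₂ := hN₂ m (le_of_max_le_right hm) n (le_of_max_le_right hn)
    rw [dist_eq_norm] at h₁ h₂ ⊢
    refine lt_of_pow_lt_pow_left₀ 2 hδ.le ?_
    rw [← hdist]
    nlinarith [norm_nonneg (ι (p (φ m)).2 - ι (p (φ n)).2),
      norm_nonneg (A (p (φ m)).2 - A (p (φ n)).2)]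
  obtain ⟨x, hx⟩ := cauchySeq_tendsto_of_complete hcauchy
  have hplim : Tendsto (fun n => p (φ n)) atTop (𝓝 (t, x)) :=
    ((continuous_fst.tendsto (t, y)).comp hlim).prodMk_nhds hx
  have hfr : (t, x) ∈ frontier W :=
    isClosed_frontier.mem_of_tendsto hplim (Eventually.of_forall fun n => hpW (φ n))
  have hιx : ι x = y := tendsto_nhds_unique ((T.continuous.tendsto x).comp hx) hιlim
  have hAx : A x = F (t, y) := tendsto_nhds_unique ((hAlip.continuous.tendsto x).comp hx) hAlim
  have hW : (t, x) ∈ W :=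
    hzW ⟨hclW (frontier_subset_closure hfr), by simp [hιx, hAx]⟩
  exact hfr.2 (hWopen.interior_eq.symm ▸ hW)
end
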